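/- Let D > 1 be a squarefree integer and K = ℚ(√D). If there exists a universal quadratic O_K-lattice of rank at most 7 over K, then D < (576283867731072000000005)². -/

import Mathlib

open NumberField

/-- `k₂, k₃`-part of four times the ternary form
`k₁² + q₂ k₂² + q₃ k₃² + b₁₂ k₁ k₂ + b₁₃ k₁ k₃ + b₂₃ k₂ k₃` after completing the square in `k₁`. -/
def ternaryTail (q₂ b₁₂ q₃ b₁₃ b₂₃ k₂ k₃ : ℤ) : ℤ :=
  (4 * q₂ - b₁₂ * b₁₂) * (k₂ * k₂) + 2 * (2 * b₂₃ - b₁₂ * b₁₃) * (k₂ * k₃) +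
    (4 * q₃ - b₁₃ * b₁₃) * (k₃ * k₃)

/-- Four times the determinant of the ternary form. -/
def ternaryDisc (q₂ b₁₂ q₃ b₁₃ b₂₃ : ℤ) : ℤ :=
  4 * q₂ * q₃ + b₁₂ * b₁₃ * b₂₃ - b₂₃ * b₂₃ - q₂ * (b₁₃ * b₁₃) - q₃ * (b₁₂ * b₁₂)

/-- Recognises the squares `0, 1, 4, …, 121` via a bit mask. -/
def isSmallSquare : ℤ → Bool
  | .ofNat m => Nat.testBit 2658457259222849844123551968029377043 m
  | .negSucc _ => false

/-- The integers `-r, …, r`. -/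
def symmRange (r : ℕ) : List ℤ := (List.range (2 * r + 1)).map fun i : ℕ => (i : ℤ) - r

/-- No value `4 n - ternaryTail` is a small square for those `|k₂| ≤ 24`, `0 ≤ k₃ ≤ 15` that are
compatible with the form taking the value `n`. -/
def ternaryMisses (q₂ b₁₂ q₃ b₁₃ b₂₃ n : ℤ) : Bool :=
  (List.range 16).all fun k₃ =>
    decide ((4 * q₂ - b₁₂ * b₁₂) * n < ternaryDisc q₂ b₁₂ q₃ b₁₃ b₂₃ * (k₃ * k₃)) ||
    (symmRange 24).all fun k₂ =>
      decide ((4 * q₃ - b₁₃ * b₁₃) * n < ternaryDisc q₂ b₁₂ q₃ b₁₃ b₂₃ * (k₂ * k₂)) ||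
      !isSmallSquare (4 * n - ternaryTail q₂ b₁₂ q₃ b₁₃ b₂₃ k₂ k₃)

/-- Every reduced positive ternary form with the given binary section and `q₃ ≤ t` misses
some integer up to `31`. -/
def ternaryCheck (q₂ b₁₂ : ℤ) (t : ℕ) : Bool :=
  (List.range (t + 1)).all fun q₃ => (symmRange 1).all fun b₁₃ => (symmRange 2).all fun b₂₃ =>
    decide ((q₃ : ℤ) < q₂) || decide (q₂ < b₂₃) || decide (b₂₃ < -q₂) ||
    decide (ternaryDisc q₂ b₁₂ q₃ b₁₃ b₂₃ ≤ 0) ||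
    [7, 10, 15, 17, 21, 22, 23, 29, 30, 31, 5, 6, 14, 13, 3].any
      (ternaryMisses q₂ b₁₂ q₃ b₁₃ b₂₃)

set_option maxRecDepth 100000 in
theorem ternaryCheck_true : ternaryCheck 1 0 3 = true ∧ ternaryCheck 1 1 2 = true ∧
    ternaryCheck 1 (-1) 2 = true ∧ ternaryCheck 2 0 5 = true ∧ ternaryCheck 2 1 3 = true ∧
    ternaryCheck 2 (-1) 3 = true := by
  decide +kernel

theorem isSmallSquare_mul_self {t : ℤ} (ht : t * t ≤ 124) : isSmallSquare (t * t) = true := by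
  have h1 : t ≤ 11 := by nlinarith
  have h2 : -11 ≤ t := by nlinarith
  interval_cases t <;> decide

theorem mem_symmRange {r : ℕ} {a : ℤ} (h₁ : -r ≤ a) (h₂ : a ≤ r) : a ∈ symmRange r := by
  refine List.mem_map.2 ⟨(a + r).toNat, List.mem_range.2 ?_, ?_⟩
  · omega
  · omega

theorem ternaryMisses_spec_of_nonneg {q₂ b₁₂ q₃ b₁₃ b₂₃ n : ℤ}
    (h : ternaryMisses q₂ b₁₂ q₃ b₁₃ b₂₃ n = true) (hn : n ≤ 31) (hn0 : 0 ≤ n)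
    (hD : 0 < ternaryDisc q₂ b₁₂ q₃ b₁₃ b₂₃) (hq₂ : 1 ≤ q₂) (hq₂' : q₂ ≤ 2)
    (hb₁₂ : b₁₂ * b₁₂ ≤ 1) (hq₃ : 1 ≤ q₃) (hq₃' : q₃ ≤ 5) (hb₁₃ : b₁₃ * b₁₃ ≤ 1)
    (k₁ k₂ : ℤ) (k₃ : ℕ) :
    k₁ * k₁ + q₂ * (k₂ * k₂) + q₃ * (k₃ * k₃) + b₁₂ * (k₁ * k₂) + b₁₃ * (k₁ * k₃) +
      b₂₃ * (k₂ * k₃) ≠ n := by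
  intro hT
  obtain ⟨D, hDdef⟩ : ∃ D, D = ternaryDisc q₂ b₁₂ q₃ b₁₃ b₂₃ := ⟨_, rfl⟩
  obtain ⟨F, hF⟩ : ∃ F, F = ternaryTail q₂ b₁₂ q₃ b₁₃ b₂₃ k₂ k₃ := ⟨_, rfl⟩
  rw [← hDdef] at hD
  have hsq : (2 * k₁ + b₁₂ * k₂ + b₁₃ * k₃) * (2 * k₁ + b₁₂ * k₂ + b₁₃ * k₃) = 4 * n - F := by
    rw [← hT, hF, ternaryTail]; ring
  have e₁ : (4 * q₂ - b₁₂ * b₁₂) * F =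
      ((4 * q₂ - b₁₂ * b₁₂) * k₂ + (2 * b₂₃ - b₁₂ * b₁₃) * k₃) ^ 2 + 4 * (D * (k₃ * k₃)) := by
    rw [hDdef, hF, ternaryTail, ternaryDisc]; ring
  have e₂ : (4 * q₃ - b₁₃ * b₁₃) * F =
      ((4 * q₃ - b₁₃ * b₁₃) * k₃ + (2 * b₂₃ - b₁₂ * b₁₃) * k₂) ^ 2 + 4 * (D * (k₂ * k₂)) := by
    rw [hDdef, hF, ternaryTail, ternaryDisc]; ring
  have hle : F ≤ 4 * n := by
    linarith [mul_self_nonneg (2 * k₁ + b₁₂ * k₂ + b₁₃ * k₃)]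
  have p₁ : 0 < 4 * q₂ - b₁₂ * b₁₂ := by linarith
  have p₂ : 0 < 4 * q₃ - b₁₃ * b₁₃ := by linarith
  have l₁ : D * (k₃ * k₃) ≤ (4 * q₂ - b₁₂ * b₁₂) * n := by
    linarith [mul_le_mul_of_nonneg_left hle p₁.le,
      sq_nonneg ((4 * q₂ - b₁₂ * b₁₂) * k₂ + (2 * b₂₃ - b₁₂ * b₁₃) * k₃)]
  have l₂ : D * (k₂ * k₂) ≤ (4 * q₃ - b₁₃ * b₁₃) * n := by
    linarith [mul_le_mul_of_nonneg_left hle p₂.le,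
      sq_nonneg ((4 * q₃ - b₁₃ * b₁₃) * k₃ + (2 * b₂₃ - b₁₂ * b₁₃) * k₂)]
  have s₁ : (k₃ : ℤ) * k₃ ≤ 8 * 31 :=
    calc (k₃ : ℤ) * k₃ ≤ D * (k₃ * k₃) := le_mul_of_one_le_left (mul_self_nonneg _) hD
      _ ≤ (4 * q₂ - b₁₂ * b₁₂) * n := l₁
      _ ≤ 8 * 31 := mul_le_mul (by linarith [mul_self_nonneg b₁₂]) hn hn0 (by norm_num)
  have s₂ : k₂ * k₂ ≤ 20 * 31 :=
    calc k₂ * k₂ ≤ D * (k₂ * k₂) := le_mul_of_one_le_left (mul_self_nonneg _) hD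
      _ ≤ (4 * q₃ - b₁₃ * b₁₃) * n := l₂
      _ ≤ 20 * 31 := mul_le_mul (by linarith [mul_self_nonneg b₁₃]) hn hn0 (by norm_num)
  have hk₃ : k₃ < 16 := by
    by_contra! hc
    have : (16 : ℤ) ≤ k₃ := by exact_mod_cast hc
    nlinarith only [this, s₁]
  have hk₂ : k₂ ∈ symmRange 24 :=
    mem_symmRange (by push_cast; nlinarith only [s₂]) (by push_cast; nlinarith only [s₂])
  rw [ternaryMisses, List.all_eq_true] at h
  have h' := h k₃ (List.mem_range.2 hk₃)
  rw [Bool.or_eq_true, decide_eq_true_iff, ← hDdef] at h'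
  have h' := h'.resolve_left (not_lt.2 l₁)
  rw [List.all_eq_true] at h'
  have h' := h' k₂ hk₂
  rw [Bool.or_eq_true, decide_eq_true_iff, ← hF] at h'
  have h' := h'.resolve_left (not_lt.2 l₂)
  have htail : 0 ≤ F := by
    refine nonneg_of_mul_nonneg_right ?_ p₁
    rw [e₁]
    have := mul_nonneg hD.le (mul_self_nonneg (k₃ : ℤ))
    positivity
  rw [← hsq, isSmallSquare_mul_self (by rw [hsq]; linarith)] at h'
  exact Bool.false_ne_true h'

theorem ternaryMisses_spec {q₂ b₁₂ q₃ b₁₃ b₂₃ n : ℤ}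
    (h : ternaryMisses q₂ b₁₂ q₃ b₁₃ b₂₃ n = true) (hn : n ≤ 31) (hn0 : 0 ≤ n)
    (hD : 0 < ternaryDisc q₂ b₁₂ q₃ b₁₃ b₂₃) (hq₂ : 1 ≤ q₂) (hq₂' : q₂ ≤ 2)
    (hb₁₂ : b₁₂ * b₁₂ ≤ 1) (hq₃ : 1 ≤ q₃) (hq₃' : q₃ ≤ 5) (hb₁₃ : b₁₃ * b₁₃ ≤ 1)
    (k₁ k₂ k₃ : ℤ) :
    k₁ * k₁ + q₂ * (k₂ * k₂) + q₃ * (k₃ * k₃) + b₁₂ * (k₁ * k₂) + b₁₃ * (k₁ * k₃) +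
      b₂₃ * (k₂ * k₃) ≠ n := by
  obtain ⟨m, rfl | rfl⟩ := k₃.eq_nat_or_neg
  · exact ternaryMisses_spec_of_nonneg h hn hn0 hD hq₂ hq₂' hb₁₂ hq₃ hq₃' hb₁₃ k₁ k₂ m
  · have := ternaryMisses_spec_of_nonneg h hn hn0 hD hq₂ hq₂' hb₁₂ hq₃ hq₃' hb₁₃ (-k₁) (-k₂) m
    intro hT
    exact this (by rw [← hT]; ring)

theorem exists_not_ternary {q₂ b₁₂ q₃ b₁₃ b₂₃ : ℤ} {t : ℕ}
    (hc : ternaryCheck q₂ b₁₂ t = true) (ht : t ≤ 5)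
    (hD : 0 < ternaryDisc q₂ b₁₂ q₃ b₁₃ b₂₃) (hq₂ : 1 ≤ q₂) (hq₂' : q₂ ≤ 2)
    (hb₁₂ : b₁₂ * b₁₂ ≤ 1) (hq₃ : q₂ ≤ q₃) (hq₃' : q₃ ≤ t) (hb₁₃ : -1 ≤ b₁₃) (hb₁₃' : b₁₃ ≤ 1)
    (hb₂₃ : -q₂ ≤ b₂₃) (hb₂₃' : b₂₃ ≤ q₂) :
    ∃ n : ℤ, 1 ≤ n ∧ n ≤ 31 ∧ ∀ k₁ k₂ k₃ : ℤ,
      k₁ * k₁ + q₂ * (k₂ * k₂) + q₃ * (k₃ * k₃) + b₁₂ * (k₁ * k₂) + b₁₃ * (k₁ * k₃) +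
        b₂₃ * (k₂ * k₃) ≠ n := by
  lift q₃ to ℕ using by linarith
  rw [ternaryCheck, List.all_eq_true] at hc
  have h := hc q₃ (List.mem_range.2 (by omega))
  have h := List.all_eq_true.1 h b₁₃ (mem_symmRange (by push_cast; linarith) (by push_cast; linarith))
  have h := List.all_eq_true.1 h b₂₃ (mem_symmRange (by push_cast; linarith) (by push_cast; linarith))
  simp only [Bool.or_eq_true, decide_eq_true_eq] at h
  have h := h.resolve_left (by
    rintro (((h | h) | h) | h) <;> linarith)
  obtain ⟨n, hn, hm⟩ := List.any_eq_true.1 h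
  have hn1 : 1 ≤ n ∧ n ≤ 31 := by
    simp only [List.mem_cons, List.not_mem_nil, or_false] at hn
    omega
  exact ⟨n, hn1.1, hn1.2, ternaryMisses_spec hm hn1.2 (by linarith) hD hq₂ hq₂' hb₁₂
    (by linarith) (by have : (t : ℤ) ≤ 5 := by exact_mod_cast ht
                      linarith) (by nlinarith)⟩

theorem Int.exists_abs_add_mul_le (a : ℤ) {c : ℤ} (hc : c ≠ 0) :
    ∃ k : ℤ, 4 * ((a + c * k) * (a + c * k)) ≤ c * c := by
  have key : ∀ c : ℤ, 0 < c → ∃ k : ℤ, 4 * ((a + c * k) * (a + c * k)) ≤ c * c := by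
    intro c hc
    refine ⟨-((2 * a + c) / (2 * c)), ?_⟩
    have h₁ := Int.emod_add_mul_ediv (2 * a + c) (2 * c)
    have h₂ := Int.emod_nonneg (2 * a + c) (by positivity : 2 * c ≠ 0)
    have h₃ := Int.emod_lt_of_pos (2 * a + c) (by positivity : 0 < 2 * c)
    generalize (2 * a + c) / (2 * c) = k at *
    generalize (2 * a + c) % (2 * c) = r at *
    have : 2 * (a + c * -k) = r - c := by linarith
    nlinarith
  rcases hc.lt_or_gt with h | h
  · obtain ⟨k, hk⟩ := key (-c) (by linarith)
    exact ⟨-k, by linarith [show a + c * -k = a + -c * k by ring ▸ hk]⟩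
  · exact key c h

namespace LinearMap.BilinForm

section PosSemidef

variable {W : Type*} [AddCommGroup W] {B : LinearMap.BilinForm ℤ W}

theorem apply_eq_zero_of_self_eq_zero (hs : ∀ x y, B x y = B y x) (hpos : ∀ x, 0 ≤ B x x)
    {x : W} (hx : B x x = 0) (y : W) : B x y = 0 := by
  by_contra h
  have h₁ := hpos (y - ((B y y + 1) * B x y) • x)
  have h₂ := hpos y
  simp only [map_sub, map_smul, LinearMap.sub_apply, LinearMap.smul_apply, smul_eq_mul, hx,
    hs y x] at h₁
  have h₃ : 1 ≤ B x y * B x y := by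
    have := mul_self_pos.2 h
    linarith
  nlinarith

theorem self_add_of_self_eq_zero (hs : ∀ x y, B x y = B y x) (hpos : ∀ x, 0 ≤ B x x)
    {x : W} (hx : B x x = 0) (y : W) : B (x + y) (x + y) = B y y := by
  have h₁ := apply_eq_zero_of_self_eq_zero hs hpos hx y
  simp only [map_add, LinearMap.add_apply, hx, h₁, hs y x]
  ring

theorem self_eq_of_sub (hs : ∀ x y, B x y = B y x) (hpos : ∀ x, 0 ≤ B x x)
    {x y : W} (hx : B (x - y) (x - y) = 0) : B x x = B y y := by
  simpa using self_add_of_self_eq_zero hs hpos hx y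

/-- Among the vectors with a given property, one has minimal norm. -/
theorem exists_minimal_self (hpos : ∀ x, 0 ≤ B x x) {p : W → Prop} (hp : ∃ x, p x) :
    ∃ e, p e ∧ ∀ x, p x → B e e ≤ B x x := by
  classical
  obtain ⟨x₀, hx₀⟩ := hp
  obtain ⟨e, he, hmin⟩ := WellFounded.has_min
    (InvImage.wf (fun x : W => (B x x).toNat) Nat.lt_wfRel.wf) {x | p x} ⟨x₀, hx₀⟩
  refine ⟨e, he, fun x hx => ?_⟩
  have h : ¬ (B x x).toNat < (B e e).toNat := hmin x hx
  have := hpos x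
  have := hpos e
  omega

theorem self_combination_three (hs : ∀ x y, B x y = B y x) {e₁ e₂ e₃ : W} {q₂ q₃ b₁₂ b₁₃ b₂₃ : ℤ}
    (h₁ : B e₁ e₁ = 2) (h₂ : B e₂ e₂ = 2 * q₂) (h₃ : B e₃ e₃ = 2 * q₃) (h₁₂ : B e₁ e₂ = b₁₂)
    (h₁₃ : B e₁ e₃ = b₁₃) (h₂₃ : B e₂ e₃ = b₂₃) (k₁ k₂ k₃ : ℤ) :
    B (k₁ • e₁ + k₂ • e₂ + k₃ • e₃) (k₁ • e₁ + k₂ • e₂ + k₃ • e₃) =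
      2 * (k₁ * k₁ + q₂ * (k₂ * k₂) + q₃ * (k₃ * k₃) + b₁₂ * (k₁ * k₂) + b₁₃ * (k₁ * k₃) +
        b₂₃ * (k₂ * k₃)) := by
  simp only [map_add, map_smul, LinearMap.add_apply, LinearMap.smul_apply, smul_eq_mul, h₁, h₂,
    h₃, h₁₂, h₁₃, h₂₃, hs e₂ e₁, hs e₃ e₁, hs e₃ e₂]
  ring

/-- Nearest-plane rounding: a vector rationally dependent on a reduced ternary frame is, modulo
the frame, shorter than the third frame vector. -/
theorem exists_reduced_of_dependent (hs : ∀ x y, B x y = B y x) (hpos : ∀ x, 0 ≤ B x x)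
    {e₁ e₂ e₃ : W} {q₂ q₃ b₁₂ b₁₃ b₂₃ : ℤ}
    (h₁ : B e₁ e₁ = 2) (h₂ : B e₂ e₂ = 2 * q₂) (h₃ : B e₃ e₃ = 2 * q₃) (h₁₂ : B e₁ e₂ = b₁₂)
    (h₁₃ : B e₁ e₃ = b₁₃) (h₂₃ : B e₂ e₃ = b₂₃) (hq₂ : 1 ≤ q₂) (hq₃ : q₂ ≤ q₃)
    (hb₁₂ : b₁₂ * b₁₂ ≤ 1) {x : W} {c c₁ c₂ c₃ : ℤ} (hc : c ≠ 0)
    (hx : B (c₁ • e₁ + c₂ • e₂ + c₃ • e₃ + c • x) (c₁ • e₁ + c₂ • e₂ + c₃ • e₃ + c • x) = 0) :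
    ∃ k₁ k₂ k₃ : ℤ, B (x - (k₁ • e₁ + k₂ • e₂ + k₃ • e₃)) (x - (k₁ • e₁ + k₂ • e₂ + k₃ • e₃)) <
      2 * q₃ := by
  set Δ := 4 * q₂ - b₁₂ * b₁₂ with hΔ
  set m := 2 * b₂₃ - b₁₂ * b₁₃ with hm
  have hΔ0 : 0 < Δ := by linarith
  obtain ⟨k₃, hk₃⟩ := Int.exists_abs_add_mul_le c₃ hc
  set d₃ := c₃ + c * k₃ with hd₃
  obtain ⟨k₂, hk₂⟩ := Int.exists_abs_add_mul_le (Δ * c₂ + m * d₃) (mul_ne_zero hΔ0.ne' hc)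
  set d₂ := c₂ + c * k₂ with hd₂
  obtain ⟨k₁, hk₁⟩ := Int.exists_abs_add_mul_le (2 * c₁ + b₁₂ * d₂ + b₁₃ * d₃)
    (mul_ne_zero two_ne_zero hc)
  set d₁ := c₁ + c * k₁ with hd₁
  refine ⟨k₁, k₂, k₃, ?_⟩
  set y := x - (k₁ • e₁ + k₂ • e₂ + k₃ • e₃) with hy
  set u := d₁ • e₁ + d₂ • e₂ + d₃ • e₃ with hu
  have huy : B (u + c • y) (u + c • y) = 0 := by
    rwa [show u + c • y = c₁ • e₁ + c₂ • e₂ + c₃ • e₃ + c • x by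
      rw [hu, hy, hd₁, hd₂, hd₃]; module]
  have hcy : B (c • y) (c • y) = B u u := by
    have := self_eq_of_sub hs hpos (x := u) (y := -(c • y)) (by simpa using huy)
    simpa using this.symm
  have hyy : c * c * B y y = B u u := by
    rw [← hcy]
    simp only [map_smul, LinearMap.smul_apply, smul_eq_mul]
    ring
  rw [hu, self_combination_three hs h₁ h₂ h₃ h₁₂ h₁₃ h₂₃] at hyy
  have e₁ : 2 * Δ * (c * c * B y y) = Δ * ((2 * d₁ + b₁₂ * d₂ + b₁₃ * d₃) *
      (2 * d₁ + b₁₂ * d₂ + b₁₃ * d₃)) + (Δ * d₂ + m * d₃) * (Δ * d₂ + m * d₃) +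
      4 * (ternaryDisc q₂ b₁₂ q₃ b₁₃ b₂₃ * (d₃ * d₃)) := by
    rw [hyy, hΔ, hm, ternaryDisc]; ring
  have f₁ : (2 * d₁ + b₁₂ * d₂ + b₁₃ * d₃) * (2 * d₁ + b₁₂ * d₂ + b₁₃ * d₃) ≤ c * c := by
    rw [show 2 * d₁ + b₁₂ * d₂ + b₁₃ * d₃ = 2 * c₁ + b₁₂ * d₂ + b₁₃ * d₃ + 2 * c * k₁ by
      rw [hd₁]; ring]
    linarith
  have f₂ : 4 * ((Δ * d₂ + m * d₃) * (Δ * d₂ + m * d₃)) ≤ Δ * c * (Δ * c) := by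
    rw [show Δ * d₂ + m * d₃ = Δ * c₂ + m * d₃ + Δ * c * k₂ by rw [hd₂]; ring]
    exact hk₂
  have hD : ternaryDisc q₂ b₁₂ q₃ b₁₃ b₂₃ ≤ Δ * q₃ := by
    have : 4 * (Δ * q₃) = Δ * (b₁₃ * b₁₃) + m * m + 4 * ternaryDisc q₂ b₁₂ q₃ b₁₃ b₂₃ := by
      rw [hΔ, hm, ternaryDisc]; ring
    linarith [mul_nonneg hΔ0.le (mul_self_nonneg b₁₃), mul_self_nonneg m]
  have hcc : 0 < c * c := mul_self_pos.2 hc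
  have f₃ : 4 * (ternaryDisc q₂ b₁₂ q₃ b₁₃ b₂₃ * (d₃ * d₃)) ≤ Δ * q₃ * (c * c) := by
    have := mul_le_mul_of_nonneg_right hD (mul_self_nonneg d₃)
    have := mul_le_mul_of_nonneg_left hk₃ (mul_nonneg hΔ0.le (by linarith : 0 ≤ q₃))
    linarith
  have f₄ : Δ ≤ 4 * q₃ := by linarith [mul_self_nonneg b₁₂]
  have g₁ : Δ * (c * c) * Δ ≤ Δ * (c * c) * (4 * q₃) :=
    mul_le_mul_of_nonneg_left f₄ (mul_pos hΔ0 hcc).le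
  have g₂ := mul_le_mul_of_nonneg_left f₁ hΔ0.le
  have g₃ : Δ * (c * c) * 1 ≤ Δ * (c * c) * q₃ :=
    mul_le_mul_of_nonneg_left (by linarith) (mul_pos hΔ0 hcc).le
  have g₄ : 0 < Δ * (c * c) * q₃ := mul_pos (mul_pos hΔ0 hcc) (by linarith)
  by_contra! hle
  have g₅ := mul_le_mul_of_nonneg_left hle (mul_pos hΔ0 hcc).le
  linarith

/-- The truants of the reduced positive binary forms `k₁² + b₁₂ k₁ k₂ + q₂ k₂²` with `q₂ ≤ 2`. -/
theorem exists_not_binary {q₂ b₁₂ : ℤ} (hq₂ : 1 ≤ q₂) (hq₂' : q₂ ≤ 2) (hb : -1 ≤ b₁₂)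
    (hb' : b₁₂ ≤ 1) :
    ∃ t : ℕ, 1 ≤ t ∧ t ≤ 5 ∧ ternaryCheck q₂ b₁₂ t = true ∧
      ∀ k₁ k₂ : ℤ, k₁ * k₁ + q₂ * (k₂ * k₂) + b₁₂ * (k₁ * k₂) ≠ t := by
  have key : ∀ t : ℕ, t ≤ 5 →
      (∀ k₁ ∈ Finset.Icc (-5 : ℤ) 5, ∀ k₂ ∈ Finset.Icc (-5 : ℤ) 5,
        k₁ * k₁ + q₂ * (k₂ * k₂) + b₁₂ * (k₁ * k₂) ≠ t) →
      ∀ k₁ k₂ : ℤ, k₁ * k₁ + q₂ * (k₂ * k₂) + b₁₂ * (k₁ * k₂) ≠ t := by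
    intro t ht h k₁ k₂ hk
    have ht' : (t : ℤ) ≤ 5 := by exact_mod_cast ht
    have hbb : b₁₂ * b₁₂ ≤ 1 := by nlinarith
    have h₁ : 3 * (k₂ * k₂) ≤ 20 := by
      nlinarith [mul_self_nonneg (2 * k₁ + b₁₂ * k₂), mul_self_nonneg k₂]
    have h₂ : 3 * (k₁ * k₁) ≤ 20 := by
      nlinarith [mul_self_nonneg (b₁₂ * k₁ + 2 * k₂), mul_self_nonneg k₁, mul_self_nonneg k₂]
    exact h k₁ (Finset.mem_Icc.2 ⟨by nlinarith, by nlinarith⟩) k₂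
      (Finset.mem_Icc.2 ⟨by nlinarith, by nlinarith⟩) hk
  obtain ⟨c₁, c₂, c₃, c₄, c₅, c₆⟩ := ternaryCheck_true
  obtain rfl | rfl : q₂ = 1 ∨ q₂ = 2 := by omega
  all_goals obtain rfl | rfl | rfl : b₁₂ = 0 ∨ b₁₂ = 1 ∨ b₁₂ = -1 := by omega
  · exact ⟨3, by norm_num, by norm_num, c₁, key 3 (by norm_num) (by decide)⟩
  · exact ⟨2, by norm_num, by norm_num, c₂, key 2 (by norm_num) (by decide)⟩
  · exact ⟨2, by norm_num, by norm_num, c₃, key 2 (by norm_num) (by decide)⟩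
  · exact ⟨5, by norm_num, by norm_num, c₄, key 5 (by norm_num) (by decide)⟩
  · exact ⟨3, by norm_num, by norm_num, c₅, key 3 (by norm_num) (by decide)⟩
  · exact ⟨3, by norm_num, by norm_num, c₆, key 3 (by norm_num) (by decide)⟩

/-- A positive semidefinite even form representing `2, 4, …, 10` contains a reduced ternary frame
whose third vector is shortest outside the binary section. -/
theorem exists_reduced_frame (hs : ∀ x y, B x y = B y x) (he : ∀ x, Even (B x x))
    (hpos : ∀ x, 0 ≤ B x x) (hrep : ∀ n : ℤ, 1 ≤ n → n ≤ 5 → ∃ w, B w w = 2 * n) :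
    ∃ (e₁ e₂ e₃ : W) (q₂ q₃ b₁₂ b₁₃ b₂₃ : ℤ) (t : ℕ), B e₁ e₁ = 2 ∧ B e₂ e₂ = 2 * q₂ ∧
      B e₃ e₃ = 2 * q₃ ∧ B e₁ e₂ = b₁₂ ∧ B e₁ e₃ = b₁₃ ∧ B e₂ e₃ = b₂₃ ∧ 1 ≤ q₂ ∧ q₂ ≤ 2 ∧
      b₁₂ * b₁₂ ≤ 1 ∧ q₂ ≤ q₃ ∧ q₃ ≤ t ∧ t ≤ 5 ∧ ternaryCheck q₂ b₁₂ t = true ∧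
      -1 ≤ b₁₃ ∧ b₁₃ ≤ 1 ∧ -q₂ ≤ b₂₃ ∧ b₂₃ ≤ q₂ ∧ 0 < ternaryDisc q₂ b₁₂ q₃ b₁₃ b₂₃ ∧
      ∀ x, (¬ ∃ k₁ k₂ : ℤ, B (x - (k₁ • e₁ + k₂ • e₂)) (x - (k₁ • e₁ + k₂ • e₂)) = 0) →
        2 * q₃ ≤ B x x := by
  obtain ⟨e₁, h₁⟩ := hrep 1 le_rfl (by norm_num)
  rw [mul_one] at h₁
  have hself : ∀ k : ℤ, B (k • e₁) (k • e₁) = 2 * (k * k) := by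
    intro k
    simp only [map_smul, LinearMap.smul_apply, smul_eq_mul, h₁]
    ring
  have hex₂ : ∃ x, ¬ ∃ k : ℤ, B (x - k • e₁) (x - k • e₁) = 0 := by
    obtain ⟨w, hw⟩ := hrep 2 (by norm_num) (by norm_num)
    refine ⟨w, fun ⟨k, hk⟩ => ?_⟩
    have := self_eq_of_sub hs hpos hk
    rw [hself, hw] at this
    have l₁ : k < 2 := by nlinarith
    have l₂ : -2 < k := by nlinarith
    interval_cases k <;> omega
  obtain ⟨e₂, he₂, hmin₂⟩ := exists_minimal_self hpos hex₂
  obtain ⟨q₂, h₂⟩ := (he e₂).two_dvd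
  obtain ⟨b₁₂, h₁₂⟩ : ∃ b, B e₁ e₂ = b := ⟨_, rfl⟩
  have hq₂ : 1 ≤ q₂ := by
    have h := hpos e₂
    have : q₂ ≠ 0 := by
      rintro rfl
      exact he₂ ⟨0, by simpa using h₂⟩
    omega
  have hq₂' : q₂ ≤ 2 := by
    obtain ⟨w, hw⟩ := hrep 2 (by norm_num) (by norm_num)
    have := hmin₂ w (fun ⟨k, hk⟩ => by
      have := self_eq_of_sub hs hpos hk
      rw [hself, hw] at this
      have l₁ : k < 2 := by nlinarith
      have l₂ : -2 < k := by nlinarith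
      interval_cases k <;> omega)
    linarith
  have hb₁₂ : -1 ≤ b₁₂ ∧ b₁₂ ≤ 1 := by
    have hm : ∀ k : ℤ, B e₂ e₂ ≤ B (e₂ + k • e₁) (e₂ + k • e₁) := fun k =>
      hmin₂ _ fun ⟨j, hj⟩ => he₂ ⟨j - k, by
        rwa [show e₂ - (j - k) • e₁ = e₂ + k • e₁ - j • e₁ by module]⟩
    have m₁ := hm 1
    have m₂ := hm (-1)
    simp only [map_add, map_smul, LinearMap.add_apply, LinearMap.smul_apply, smul_eq_mul, h₁,
      h₁₂, hs e₂ e₁] at m₁ m₂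
    constructor <;> linarith
  obtain ⟨t, ht1, ht5, hcheck, htr⟩ := exists_not_binary hq₂ hq₂' hb₁₂.1 hb₁₂.2
  have hself₂ : ∀ k₁ k₂ : ℤ, B (k₁ • e₁ + k₂ • e₂) (k₁ • e₁ + k₂ • e₂) =
      2 * (k₁ * k₁ + q₂ * (k₂ * k₂) + b₁₂ * (k₁ * k₂)) := by
    intro k₁ k₂
    simp only [map_add, map_smul, LinearMap.add_apply, LinearMap.smul_apply, smul_eq_mul, h₁,
      h₁₂, hs e₂ e₁, h₂]
    ring
  obtain ⟨w, hw⟩ := hrep t (by exact_mod_cast ht1) (by exact_mod_cast ht5)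
  have hwt : ¬ ∃ k₁ k₂ : ℤ, B (w - (k₁ • e₁ + k₂ • e₂)) (w - (k₁ • e₁ + k₂ • e₂)) = 0 := by
    rintro ⟨k₁, k₂, hk⟩
    have := self_eq_of_sub hs hpos hk
    rw [hself₂, hw] at this
    exact htr k₁ k₂ (by linarith)
  obtain ⟨e₃, he₃, hmin₃⟩ := exists_minimal_self hpos (p := fun x => ¬ ∃ k₁ k₂ : ℤ,
    B (x - (k₁ • e₁ + k₂ • e₂)) (x - (k₁ • e₁ + k₂ • e₂)) = 0) ⟨w, hwt⟩
  obtain ⟨q₃, h₃⟩ := (he e₃).two_dvd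
  obtain ⟨b₁₃, h₁₃⟩ : ∃ b, B e₁ e₃ = b := ⟨_, rfl⟩
  obtain ⟨b₂₃, h₂₃⟩ : ∃ b, B e₂ e₃ = b := ⟨_, rfl⟩
  have hq₃ : q₂ ≤ q₃ := by
    have := hmin₂ e₃ fun ⟨k, hk⟩ => he₃ ⟨k, 0, by simpa using hk⟩
    linarith
  have hq₃' : q₃ ≤ t := by
    have := hmin₃ w hwt
    linarith
  have hm : ∀ j k : ℤ, B e₃ e₃ ≤ B (e₃ + (j • e₁ + k • e₂)) (e₃ + (j • e₁ + k • e₂)) := fun j k =>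
    hmin₃ _ fun ⟨k₁, k₂, hk⟩ => he₃ ⟨k₁ - j, k₂ - k, by
      rwa [show e₃ - ((k₁ - j) • e₁ + (k₂ - k) • e₂) =
        e₃ + (j • e₁ + k • e₂) - (k₁ • e₁ + k₂ • e₂) by module]⟩
  have hcomb := self_combination_three hs h₁ h₂ h₃ h₁₂ h₁₃ h₂₃
  have hm' : ∀ j k : ℤ, q₃ ≤ j * j + q₂ * (k * k) + q₃ * (1 * 1) + b₁₂ * (j * k) + b₁₃ * (j * 1) +
      b₂₃ * (k * 1) := by
    intro j k
    have h := hm j k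
    rw [add_comm e₃, ← one_smul ℤ e₃, hcomb, one_smul, h₃] at h
    linarith
  have m₁ := hm' 1 0
  have m₂ := hm' (-1) 0
  have m₃ := hm' 0 1
  have m₄ := hm' 0 (-1)
  have hb₁₃ : -1 ≤ b₁₃ := by linarith
  have hb₁₃' : b₁₃ ≤ 1 := by linarith
  have hb₂₃ : -q₂ ≤ b₂₃ := by linarith
  have hb₂₃' : b₂₃ ≤ q₂ := by linarith
  have hnull : ∀ j k : ℤ, j * j + q₂ * (k * k) + q₃ * (1 * 1) + b₁₂ * (j * k) + b₁₃ * (j * 1) +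
      b₂₃ * (k * 1) ≠ 0 := by
    intro j k h
    have h' := hcomb j k 1
    rw [h, mul_zero, one_smul] at h'
    refine he₃ ⟨-j, -k, ?_⟩
    rwa [show e₃ - (-j • e₁ + -k • e₂) = j • e₁ + k • e₂ + e₃ by module]
  refine ⟨e₁, e₂, e₃, q₂, q₃, b₁₂, b₁₃, b₂₃, t, h₁, h₂, h₃, h₁₂, h₁₃, h₂₃, hq₂, hq₂', ?_, hq₃,
    hq₃', ht5, hcheck, hb₁₃, hb₁₃', hb₂₃, hb₂₃', ?_, fun x hx => h₃ ▸ hmin₃ x hx⟩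
  · nlinarith
  · obtain ⟨hb₁₂, hb₁₂'⟩ := hb₁₂
    have ht5' : (t : ℤ) ≤ 5 := by exact_mod_cast ht5
    have hq₃'' : q₃ ≤ 5 := hq₃'.trans ht5'
    have hn := hnull (-b₁₃) (-b₂₃)
    clear hnull hm' hcomb hm hmin₃ htr hself₂ hmin₂ hself hrep
    rw [ternaryDisc]
    interval_cases q₂ <;> interval_cases b₁₂ <;> interval_cases b₁₃ <;> interval_cases b₂₃ <;>
      omega

/-- A positive semidefinite even form representing `2, 4, …, 62` has rank at least four. -/
theorem exists_posDef_four (hs : ∀ x y, B x y = B y x) (he : ∀ x, Even (B x x))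
    (hpos : ∀ x, 0 ≤ B x x) (hrep : ∀ n : ℤ, 1 ≤ n → n ≤ 31 → ∃ w, B w w = 2 * n) :
    ∃ x : Fin 4 → W, ∀ c : Fin 4 → ℤ, c ≠ 0 → 0 < B (∑ i, c i • x i) (∑ i, c i • x i) := by
  obtain ⟨e₁, e₂, e₃, q₂, q₃, b₁₂, b₁₃, b₂₃, t, h₁, h₂, h₃, h₁₂, h₁₃, h₂₃, hq₂, hq₂', hb₁₂, hq₃,
    hq₃', ht5, hcheck, hb₁₃, hb₁₃', hb₂₃, hb₂₃', hD, hmin⟩ :=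
    exists_reduced_frame hs he hpos fun n hn hn' => hrep n hn (by linarith)
  have hcomb := self_combination_three hs h₁ h₂ h₃ h₁₂ h₁₃ h₂₃
  by_contra! hcon
  have hspan : ∀ x, ∃ k₁ k₂ k₃ : ℤ,
      B (x - (k₁ • e₁ + k₂ • e₂ + k₃ • e₃)) (x - (k₁ • e₁ + k₂ • e₂ + k₃ • e₃)) = 0 := by
    intro x
    obtain ⟨c, hc, hle⟩ := hcon ![e₁, e₂, e₃, x]
    have h0 := le_antisymm hle (hpos _)
    simp only [Fin.sum_univ_four, Matrix.cons_val] at h0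
    have hc3 : c 3 ≠ 0 := by
      intro hc3
      rw [hc3, zero_smul, add_zero, hcomb] at h0
      refine hc ?_
      have hΔ : 0 < 4 * q₂ - b₁₂ * b₁₂ := by linarith
      have k₁ : (4 * q₂ - b₁₂ * b₁₂) * ((2 * c 0 + b₁₂ * c 1 + b₁₃ * c 2) ^ 2) +
          ((4 * q₂ - b₁₂ * b₁₂) * c 1 + (2 * b₂₃ - b₁₂ * b₁₃) * c 2) ^ 2 +
          4 * (ternaryDisc q₂ b₁₂ q₃ b₁₃ b₂₃ * (c 2) ^ 2) = 0 := by
        rw [ternaryDisc]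
        linear_combination 2 * (4 * q₂ - b₁₂ * b₁₂) * h0
      have s₁ := mul_nonneg hΔ.le (sq_nonneg (2 * c 0 + b₁₂ * c 1 + b₁₃ * c 2))
      have s₂ := sq_nonneg ((4 * q₂ - b₁₂ * b₁₂) * c 1 + (2 * b₂₃ - b₁₂ * b₁₃) * c 2)
      have s₃ := mul_nonneg hD.le (sq_nonneg (c 2))
      have z₂ : c 2 = 0 := by
        have : ternaryDisc q₂ b₁₂ q₃ b₁₃ b₂₃ * (c 2) ^ 2 = 0 := by linarith
        simpa [hD.ne'] using this
      have z₁ : c 1 = 0 := by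
        have : ((4 * q₂ - b₁₂ * b₁₂) * c 1 + (2 * b₂₃ - b₁₂ * b₁₃) * c 2) ^ 2 = 0 := by linarith
        simpa [hΔ.ne', z₂] using this
      have z₀ : c 0 = 0 := by
        have : (4 * q₂ - b₁₂ * b₁₂) * ((2 * c 0 + b₁₂ * c 1 + b₁₃ * c 2) ^ 2) = 0 := by linarith
        simpa [hΔ.ne', z₂, z₁] using this
      ext i
      fin_cases i <;> assumption
    obtain ⟨k₁, k₂, k₃, hk⟩ := exists_reduced_of_dependent hs hpos h₁ h₂ h₃ h₁₂ h₁₃ h₂₃ hq₂ hq₃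
      hb₁₂ hc3 h0
    by_contra! hx
    refine absurd (hmin _ ?_) (not_le.2 hk)
    rintro ⟨j₁, j₂, hj⟩
    refine hx (k₁ + j₁) (k₂ + j₂) k₃ ?_
    rwa [show x - ((k₁ + j₁) • e₁ + (k₂ + j₂) • e₂ + k₃ • e₃) =
      x - (k₁ • e₁ + k₂ • e₂ + k₃ • e₃) - (j₁ • e₁ + j₂ • e₂) by module]
  obtain ⟨n, hn, hn', hne⟩ := exists_not_ternary hcheck ht5 hD hq₂ hq₂' hb₁₂ hq₃ hq₃' hb₁₃ hb₁₃'
    hb₂₃ hb₂₃'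
  obtain ⟨w, hw⟩ := hrep n hn hn'
  obtain ⟨k₁, k₂, k₃, hk⟩ := hspan w
  have := self_eq_of_sub hs hpos hk
  rw [hw, hcomb] at this
  exact hne k₁ k₂ k₃ (by linarith)

end PosSemidef

section Gram

variable {G : Type*} [AddCommGroup G] {B : LinearMap.BilinForm ℤ G}

theorem apply_eq_zero_of_mem_span {ι κ : Type*} {f : ι → G} {g : κ → G}
    (h : ∀ i j, B (f i) (g j) = 0) {x y : G} (hx : x ∈ Submodule.span ℤ (Set.range f))
    (hy : y ∈ Submodule.span ℤ (Set.range g)) : B x y = 0 := by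
  have h₁ : ∀ i, Submodule.span ℤ (Set.range g) ≤ LinearMap.ker (B (f i)) := fun i =>
    Submodule.span_le.2 (Set.range_subset_iff.2 fun j => h i j)
  have h₂ : Submodule.span ℤ (Set.range f) ≤ LinearMap.ker (B.flip y) :=
    Submodule.span_le.2 (Set.range_subset_iff.2 fun i => h₁ i hy)
  exact h₂ hx

/-- Gram matrix of a family of vectors. -/
def gram {ι : Type*} (B : LinearMap.BilinForm ℤ G) (x : ι → G) : Matrix ι ι ℤ :=
  Matrix.of fun i j => B (x i) (x j)

theorem apply_sum_smul {ι : Type*} [Fintype ι] (x : ι → G) (y : G) (c : ι → ℤ) :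
    B y (∑ i, c i • x i) = ∑ i, B y (x i) * c i := by
  simp [mul_comm]

theorem self_sum_smul {ι : Type*} [Fintype ι] (x : ι → G) (c : ι → ℤ) :
    B (∑ i, c i • x i) (∑ i, c i • x i) = c ⬝ᵥ (gram B x).mulVec c := by
  simp only [dotProduct, Matrix.mulVec, gram, Matrix.of_apply, map_sum, map_smul,
    LinearMap.sum_apply, LinearMap.smul_apply, smul_eq_mul, Finset.mul_sum]
  rw [Finset.sum_comm]
  refine Finset.sum_congr rfl fun i _ => Finset.sum_congr rfl fun j _ => ?_
  ring

theorem det_gram_ne_zero {ι : Type*} [Fintype ι] [DecidableEq ι] {x : ι → G}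
    (hx : ∀ c : ι → ℤ, c ≠ 0 → 0 < B (∑ i, c i • x i) (∑ i, c i • x i)) :
    (gram B x).det ≠ 0 := by
  intro h
  obtain ⟨v, hv, hv0⟩ := Matrix.exists_mulVec_eq_zero_iff.2 h
  have := hx v hv
  rw [self_sum_smul, hv0, dotProduct_zero] at this
  exact lt_irrefl _ this

theorem abs_det_le {k : ℕ} (hk : k ≤ 3) {b : ℤ} (hb : 1 ≤ b) {M : Matrix (Fin k) (Fin k) ℤ}
    (hM : ∀ i j, |M i j| ≤ b) : |M.det| ≤ 6 * b ^ 3 := by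
  have h := Matrix.det_le (abv := AbsoluteValue.abs) (A := M) (x := b) hM
  rw [AbsoluteValue.abs_apply, Fintype.card_fin, nsmul_eq_mul] at h
  refine h.trans (mul_le_mul ?_ (pow_le_pow_right₀ hb hk) (by positivity) (by norm_num))
  exact_mod_cast Nat.factorial_le hk

/-- Orthogonal residue of `y`, scaled by the Gram determinant, with respect to a finite family. -/
noncomputable def residue {k : ℕ} (B : LinearMap.BilinForm ℤ G) (x : Fin k → G) (y : G) : G :=
  (gram B x).det • y - ∑ i, Matrix.cramer (gram B x) (fun j => B (x j) y) i • x i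

theorem apply_residue {k : ℕ} (x : Fin k → G) (y : G) (j : Fin k) :
    B (x j) (residue B x y) = 0 := by
  have h := congrFun (Matrix.mulVec_cramer (gram B x) fun j => B (x j) y) j
  rw [residue, map_sub, apply_sum_smul, map_smul, sub_eq_zero]
  exact h.symm

variable {h : G → ℝ}

theorem height_sum_le (hadd : ∀ x y, h (x + y) ≤ 2 * (h x + h y)) (h0 : h 0 = 0) {M : ℝ} :
    ∀ {k : ℕ} (x : Fin k → G), (∀ i, h (x i) ≤ M) → h (∑ i, x i) ≤ (2 ^ (k + 1) - 2) * M
  | 0, x, _ => by simp [h0]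
  | k + 1, x, hx => by
    rw [Fin.sum_univ_succ]
    have h₁ := height_sum_le hadd h0 (fun i : Fin k => x i.succ) fun i => hx _
    have h₂ := hadd (x 0) (∑ i : Fin k, x i.succ)
    have h₃ := hx 0
    calc _ ≤ 2 * (h (x 0) + h (∑ i : Fin k, x i.succ)) := h₂
      _ ≤ 2 * (M + (2 ^ (k + 1) - 2) * M) := by linarith
      _ = _ := by ring

theorem height_residue_le (hadd : ∀ x y, h (x + y) ≤ 2 * (h x + h y))
    (hsmul : ∀ (n : ℤ) x, h (n • x) = n ^ 2 * h x) (hnonneg : ∀ x, 0 ≤ h x) {k : ℕ} (hk : k ≤ 3)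
    {b : ℤ} (hb : 1 ≤ b) {H : ℝ} {x : Fin k → G} {y : G} (hx : ∀ i, h (x i) ≤ H) (hy : h y ≤ H)
    (hxx : ∀ i j, |B (x i) (x j)| ≤ b) (hxy : ∀ i, |B (x i) y| ≤ b) :
    h (residue B x y) ≤ 1080 * b ^ 6 * H := by
  have hH : 0 ≤ H := (hnonneg y).trans hy
  have h0 : h 0 = 0 := by simpa using hsmul 0 0
  have hscal : ∀ (n : ℤ) (z : G), |n| ≤ 6 * b ^ 3 → h z ≤ H → h (n • z) ≤ 36 * b ^ 6 * H := by
    intro n z hn hz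
    rw [hsmul]
    refine mul_le_mul ?_ hz (hnonneg z) (by positivity)
    have : n ^ 2 ≤ (6 * b ^ 3) ^ 2 := sq_le_sq' (by linarith [abs_le.1 hn]) (abs_le.1 hn).2
    calc (n : ℝ) ^ 2 ≤ (6 * (b : ℝ) ^ 3) ^ 2 := by exact_mod_cast this
      _ = _ := by ring
  have h₁ : h ((gram B x).det • y) ≤ 36 * b ^ 6 * H :=
    hscal _ _ (abs_det_le hk hb hxx) hy
  have h₂ : h (∑ i, (-Matrix.cramer (gram B x) (fun j => B (x j) y) i) • x i) ≤
      (2 ^ (k + 1) - 2) * (36 * b ^ 6 * H) := by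
    refine height_sum_le hadd h0 _ fun i => hscal _ _ ?_ (hx i)
    rw [abs_neg, Matrix.cramer_apply]
    refine abs_det_le hk hb fun l m => ?_
    rw [Matrix.updateCol_apply]
    split_ifs
    · exact hxy l
    · exact hxx l m
  have h₃ : (2 : ℝ) ^ (k + 1) ≤ 2 ^ 4 := pow_le_pow_right₀ (by norm_num) (by omega)
  have h₄ : 0 ≤ 36 * (b : ℝ) ^ 6 * H := by positivity
  rw [residue, sub_eq_add_neg, ← Finset.sum_neg_distrib]
  simp only [← neg_smul]
  refine (hadd _ _).trans ?_
  have h₅ := mul_le_mul_of_nonneg_right h₃ h₄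
  linarith

/-- A form that is nonnegative on vectors of small height either is positive definite on four of
the given vectors, or positive semidefinite on their span. -/
theorem posDef_four_or_posSemidef (hs : ∀ x y, B x y = B y x)
    (hadd : ∀ x y, h (x + y) ≤ 2 * (h x + h y))
    (hsmul : ∀ (n : ℤ) x, h (n • x) = n ^ 2 * h x) (hnonneg : ∀ x, 0 ≤ h x)
    {ι : Type*} {w : ι → G} {b : ℤ} (hb : 1 ≤ b) {H : ℝ} (hw : ∀ i, h (w i) ≤ H)
    (hww : ∀ i j, |B (w i) (w j)| ≤ b)
    (hsmall : ∀ x, h x ≤ 4320 * b ^ 6 * H → 0 ≤ B x x) :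
    (∃ I : Fin 4 → ι, ∀ c : Fin 4 → ℤ, c ≠ 0 →
      0 < B (∑ i, c i • w (I i)) (∑ i, c i • w (I i))) ∨
    ∀ x ∈ Submodule.span ℤ (Set.range w), 0 ≤ B x x := by
  by_cases hpsd : ∀ x ∈ Submodule.span ℤ (Set.range w), 0 ≤ B x x
  · exact Or.inr hpsd
  refine Or.inl ?_
  have key : ∀ k : ℕ, k ≤ 4 → ∃ I : Fin k → ι, ∀ c : Fin k → ℤ, c ≠ 0 →
      0 < B (∑ i, c i • w (I i)) (∑ i, c i • w (I i)) := by
    intro k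
    induction k with
    | zero => exact fun _ => ⟨Fin.elim0, fun c hc => absurd (Subsingleton.elim _ _) hc⟩
    | succ k ih =>
      intro hk
      obtain ⟨I, hI⟩ := ih (by omega)
      have hd := det_gram_ne_zero hI
      have hI0 : ∀ c : Fin k → ℤ, 0 ≤ B (∑ i, c i • w (I i)) (∑ i, c i • w (I i)) := by
        intro c
        by_cases hc : c = 0
        · simp [hc]
        · exact (hI c hc).le
      set r : ι → G := fun n => residue B (fun i => w (I i)) (w n) with hr
      have hrI : ∀ i n, B (w (I i)) (r n) = 0 := fun i n => apply_residue (fun i => w (I i)) (w n) i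
      have hht : ∀ n, h (r n) ≤ 1080 * b ^ 6 * H := fun n =>
        height_residue_le hadd hsmul hnonneg (by omega) hb (fun i => hw _) (hw n)
          (fun i j => hww _ _) fun i => hww _ _
      have hbH : ∀ n : ι, 0 ≤ (b : ℝ) ^ 6 * H := fun n =>
        mul_nonneg (by positivity) ((hnonneg _).trans (hw n))
      have hpos : ∀ m n (s : ℤ), s ^ 2 = 1 → 0 ≤ B (r m + s • r n) (r m + s • r n) := by
        intro m n s hs1
        refine hsmall _ ((hadd _ _).trans ?_)
        have hs1' : (s : ℝ) ^ 2 = 1 := by exact_mod_cast hs1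
        rw [hsmul, hs1', one_mul]
        linarith [hht m, hht n]
      have hpos' : ∀ n, 0 ≤ B (r n) (r n) := fun n =>
        hsmall _ (by linarith [hht n, hbH n])
      by_cases hall : ∀ n, B (r n) (r n) = 0
      · have hrr : ∀ m n, B (r m) (r n) = 0 := by
          intro m n
          have h₁ := hpos m n 1 (by norm_num)
          have h₂ := hpos m n (-1) (by norm_num)
          simp only [map_add, map_smul, LinearMap.add_apply, LinearMap.smul_apply, smul_eq_mul,
            hall, hs (r n) (r m)] at h₁ h₂
          linarith
        refine absurd (fun x hx => ?_) hpsd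
        have hle : Submodule.span ℤ (Set.range w) ≤
            (Submodule.span ℤ (Set.range fun i => w (I i)) ⊔
              Submodule.span ℤ (Set.range r)).comap
              (LinearMap.lsmul ℤ G (gram B fun i => w (I i)).det) := by
          refine Submodule.span_le.2 (Set.range_subset_iff.2 fun n => ?_)
          refine Submodule.mem_sup.2 ⟨∑ i, Matrix.cramer (gram B fun i => w (I i))
            (fun j => B (w (I j)) (w n)) i • w (I i),
            Submodule.sum_mem _ fun i _ => Submodule.smul_mem _ _
              (Submodule.subset_span ⟨i, rfl⟩), r n, Submodule.subset_span ⟨n, rfl⟩, ?_⟩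
          rw [hr]
          simp [residue]
        obtain ⟨u, hu, v, hv, huv⟩ := Submodule.mem_sup.1 (hle hx)
        have huv0 : B u v = 0 := apply_eq_zero_of_mem_span hrI hu hv
        have hvv0 : B v v = 0 := apply_eq_zero_of_mem_span hrr hv hv
        obtain ⟨c, rfl⟩ := (Submodule.mem_span_range_iff_exists_fun ℤ).1 hu
        have h₁ := congrArg (fun z => B z z) huv
        simp only [map_add, LinearMap.add_apply, hvv0, huv0, hs v, LinearMap.lsmul_apply,
          map_smul, LinearMap.smul_apply, smul_eq_mul, add_zero] at h₁
        have h₂ := hI0 c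
        rw [h₁, ← mul_assoc] at h₂
        exact nonneg_of_mul_nonneg_right h₂ (mul_self_pos.2 hd)
      · push Not at hall
        obtain ⟨n, hn⟩ := hall
        have hn' : 0 < B (r n) (r n) := lt_of_le_of_ne (hpos' n) hn.symm
        refine ⟨Fin.cons n I, fun c hc => ?_⟩
        simp only [Fin.sum_univ_succ, Fin.cons_zero, Fin.cons_succ]
        set z := c 0 • w n + ∑ i : Fin k, c i.succ • w (I i) with hz
        set e : Fin k → ℤ := fun i => c 0 * Matrix.cramer (gram B fun i => w (I i))
            (fun j => B (w (I j)) (w n)) i + (gram B fun i => w (I i)).det * c i.succ with he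
        have hdz : (gram B fun i => w (I i)).det • z = c 0 • r n + ∑ i, e i • w (I i) := by
          rw [hz, hr, he]
          simp only [residue, add_smul, mul_smul, Finset.sum_add_distrib, smul_add, smul_sub,
            ← Finset.smul_sum]
          rw [smul_comm (c 0)]
          abel
        have horth : B (r n) (∑ i, e i • w (I i)) = 0 := by
          rw [apply_sum_smul]
          exact Finset.sum_eq_zero fun i _ => by rw [hs, hrI, zero_mul]
        have h₁ := congrArg (fun z => B z z) hdz
        simp only [map_add, LinearMap.add_apply, map_smul, LinearMap.smul_apply, smul_eq_mul,
          horth, hs (∑ i, e i • w (I i)) (r n)] at h₁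
        have h₂ : 0 < c 0 * (c 0 * B (r n) (r n)) + B (∑ i, e i • w (I i)) (∑ i, e i • w (I i)) := by
          by_cases hc0 : c 0 = 0
          · rw [hc0, zero_mul, zero_add]
            refine hI e fun he0 => hc ?_
            ext i
            refine Fin.cases hc0 (fun j => ?_) i
            have := congrFun he0 j
            simpa [he, hc0, hd] using this
          · rw [← mul_assoc]
            exact add_pos_of_pos_of_nonneg (mul_pos (mul_self_pos.2 hc0) hn') (hI0 e)
        have h₃ : 0 < (gram B fun i => w (I i)).det * (gram B fun i => w (I i)).det * B z z := by
          linarith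
        exact (mul_pos_iff_of_pos_left (mul_self_pos.2 hd)).1 h₃
  exact key 4 le_rfl

end Gram

end LinearMap.BilinForm

theorem Matrix.dotProduct_mulVec_nonneg_of_int {ι : Type*} [Fintype ι] {M : Matrix ι ι ℝ}
    (h : ∀ c : ι → ℤ, 0 ≤ (fun i => (c i : ℝ)) ⬝ᵥ M.mulVec fun i => (c i : ℝ)) (c : ι → ℝ) :
    0 ≤ c ⬝ᵥ M.mulVec c := by
  have hclosed : IsClosed {c : ι → ℝ | 0 ≤ c ⬝ᵥ M.mulVec c} := by
    refine isClosed_le continuous_const ?_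
    simp only [dotProduct, Matrix.mulVec]
    fun_prop
  have hdense : DenseRange fun (q : ι → ℚ) (i : ι) => (q i : ℝ) :=
    DenseRange.piMap fun _ => Rat.denseRange_cast
  refine hdense.induction_on (p := fun c => 0 ≤ c ⬝ᵥ M.mulVec c) c hclosed fun q => ?_
  set d : ℕ := ∏ i, (q i).den with hd
  have hd0 : (0 : ℝ) < d := by
    rw [hd]
    exact_mod_cast Finset.prod_pos fun i _ => (q i).den_pos
  have hq : ∀ i, ∃ k : ℤ, (k : ℝ) = d * q i := by
    intro i
    obtain ⟨e, he⟩ := Finset.dvd_prod_of_mem (fun i => (q i).den) (Finset.mem_univ i)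
    refine ⟨e * (q i).num, ?_⟩
    have : (q i : ℝ) * (q i).den = (q i).num := by exact_mod_cast Rat.mul_den_eq_num (q i)
    rw [hd, he]
    push_cast
    rw [← this]
    ring
  choose k hk using hq
  have h₁ := h k
  have hkq : (fun i => (k i : ℝ)) = (d : ℝ) • fun i => (q i : ℝ) := by
    ext i
    simp [hk]
  rw [hkq, Matrix.mulVec_smul, dotProduct_smul, smul_dotProduct, smul_eq_mul, smul_eq_mul] at h₁
  exact nonneg_of_mul_nonneg_right (nonneg_of_mul_nonneg_right h₁ hd0) hd0

theorem Matrix.eq_zero_of_dotProduct_mulVec_map_eq_zero {ι : Type*} [Fintype ι]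
    {M : Matrix ι ι ℤ} (hM : M.IsSymm) (hpos : ∀ c : ι → ℤ, c ≠ 0 → 0 < c ⬝ᵥ M.mulVec c)
    {c : ι → ℝ} (hc : c ⬝ᵥ (M.map (Int.cast : ℤ → ℝ)).mulVec c = 0) : c = 0 := by
  classical
  have hnonneg := Matrix.dotProduct_mulVec_nonneg_of_int (M := M.map (Int.cast : ℤ → ℝ)) fun c => by
    have h0 : 0 ≤ c ⬝ᵥ M.mulVec c := by
      by_cases hc : c = 0
      · simp [hc]
      · exact (hpos c hc).le
    have : ((c ⬝ᵥ M.mulVec c : ℤ) : ℝ) =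
        (fun i => (c i : ℝ)) ⬝ᵥ (M.map (Int.cast : ℤ → ℝ)).mulVec fun i => (c i : ℝ) := by
      simp [dotProduct, Matrix.mulVec]
    rw [← this]
    exact_mod_cast h0
  have hpsd : (M.map (Int.cast : ℤ → ℝ)).PosSemidef := by
    refine Matrix.PosSemidef.of_dotProduct_mulVec_nonneg ?_ fun c => by simpa using hnonneg c
    ext i j
    simpa using congrArg (Int.cast : ℤ → ℝ) (hM.apply i j)
  have h0 := (hpsd.dotProduct_mulVec_zero_iff c).1 (by simpa using hc)
  by_contra hne
  have hdet : (M.map (Int.cast : ℤ → ℝ)).det = 0 :=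
    Matrix.exists_mulVec_eq_zero_iff.1 ⟨c, hne, h0⟩
  have hdet' : M.det = 0 := by
    have := (Int.castRingHom ℝ).map_det M
    rw [RingHom.mapMatrix_apply] at this
    have h : ((M.det : ℤ) : ℝ) = 0 := this.trans hdet
    exact_mod_cast h
  obtain ⟨v, hv, hv0⟩ := Matrix.exists_mulVec_eq_zero_iff.2 hdet'
  have := hpos v hv
  rw [hv0, dotProduct_zero] at this
  exact lt_irrefl _ this

namespace LinearMap.BilinForm

section Pencil

variable {G : Type*} [AddCommGroup G] {A B : LinearMap.BilinForm ℤ G}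

theorem exists_posDef_four_of_span (hs : ∀ x y, B x y = B y x) (he : ∀ x, Even (B x x))
    {w : Fin 31 → G} (hw : ∀ i, B (w i) (w i) = 2 * ((i : ℤ) + 1))
    (hpos : ∀ x ∈ Submodule.span ℤ (Set.range w), 0 ≤ B x x) :
    ∃ x : Fin 4 → G, (∀ i, x i ∈ Submodule.span ℤ (Set.range w)) ∧
      ∀ c : Fin 4 → ℤ, c ≠ 0 → 0 < B (∑ i, c i • x i) (∑ i, c i • x i) := by
  set S := Submodule.span ℤ (Set.range w) with hS
  obtain ⟨x, hx⟩ := exists_posDef_four (B := B.restrict S) (fun x y => hs x y) (fun x => he x)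
    (fun x => hpos x x.2) fun n hn hn' => by
      refine ⟨⟨w ⟨(n - 1).toNat, by omega⟩, Submodule.subset_span ⟨_, rfl⟩⟩, ?_⟩
      refine (hw _).trans ?_
      simp only
      omega
  refine ⟨fun i => x i, fun i => (x i).2, fun c hc => ?_⟩
  have := hx c hc
  rw [LinearMap.BilinForm.restrict_apply] at this
  simpa using this

theorem abs_two_mul_apply_le (hsA : ∀ x y, A x y = A y x) (hsB : ∀ x y, B x y = B y x) {α : ℝ}
    (hP : ∀ x, 0 ≤ (A x x : ℝ) + α * B x x) (k : ℤ) (x y : G) :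
    |2 * k * ((A x y : ℝ) + α * B x y)| ≤
      k ^ 2 * ((A x x : ℝ) + α * B x x) + ((A y y : ℝ) + α * B y y) := by
  have h₁ := hP (k • x + y)
  have h₂ := hP (k • x - y)
  simp only [map_add, map_sub, LinearMap.sub_apply, LinearMap.add_apply, map_smul,
    LinearMap.smul_apply, smul_eq_mul, hsA y x, hsB y x] at h₁ h₂
  push_cast at h₁ h₂
  rw [abs_le]
  constructor <;> linarith

theorem pencil_dotProduct_nonneg {ι : Type*} [Fintype ι] {α : ℝ}
    (hP : ∀ x, 0 ≤ (A x x : ℝ) + α * B x x) (z : ι → G) (c : ι → ℝ) :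
    0 ≤ c ⬝ᵥ ((gram A z).map (Int.cast : ℤ → ℝ)).mulVec c +
      α * (c ⬝ᵥ ((gram B z).map (Int.cast : ℤ → ℝ)).mulVec c) := by
  have hcast : ∀ (M : Matrix ι ι ℤ) (c : ι → ℤ), ((c ⬝ᵥ M.mulVec c : ℤ) : ℝ) =
      (fun i => (c i : ℝ)) ⬝ᵥ (M.map (Int.cast : ℤ → ℝ)).mulVec fun i => (c i : ℝ) := by
    intro M c
    simp [dotProduct, Matrix.mulVec]
  have key := Matrix.dotProduct_mulVec_nonneg_of_int
    (M := (gram A z).map (Int.cast : ℤ → ℝ) + α • (gram B z).map (Int.cast : ℤ → ℝ)) (fun c => by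
      rw [Matrix.add_mulVec, Matrix.smul_mulVec, dotProduct_add, dotProduct_smul, smul_eq_mul,
        ← hcast, ← hcast, ← self_sum_smul, ← self_sum_smul]
      exact hP _) c
  rwa [Matrix.add_mulVec, Matrix.smul_mulVec, dotProduct_add, dotProduct_smul, smul_eq_mul] at key

theorem isSymm_gram {ι : Type*} (hs : ∀ x y, B x y = B y x) (z : ι → G) : (gram B z).IsSymm := by
  ext i j
  exact hs _ _

/-- If both `A + α B` and `A + α' B` are positive semidefinite for two well separated reals `α` and
`α'`, then `A + α B` is nondegenerate on eight suitable vectors. -/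
theorem exists_eight_nondegenerate (hsA : ∀ x y, A x y = A y x) (hsB : ∀ x y, B x y = B y x)
    (heA : ∀ x, Even (A x x)) (heB : ∀ x, Even (B x x)) {α α' : ℝ} (h0 : 0 < α') (h1 : α' ≤ 1)
    (hδ : (10 : ℝ) ^ 23 ≤ α - α') (hP : ∀ x, 0 ≤ (A x x : ℝ) + α * B x x)
    (hP' : ∀ x, 0 ≤ (A x x : ℝ) + α' * B x x) {v w : Fin 31 → G}
    (hvA : ∀ i, A (v i) (v i) = 2 * ((i : ℤ) + 1)) (hvB : ∀ i, B (v i) (v i) = 0)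
    (hwA : ∀ i, A (w i) (w i) = 0) (hwB : ∀ i, B (w i) (w i) = 2 * ((i : ℤ) + 1)) :
    ∃ z : Fin 4 ⊕ Fin 4 → G, ∀ c : Fin 4 ⊕ Fin 4 → ℝ,
      (∀ i, ∑ j, ((A (z i) (z j) : ℝ) + α * B (z i) (z j)) * c j = 0) → c = 0 := by
  have hi : ∀ i : Fin 31, ((i : ℕ) : ℝ) + 1 ≤ 31 := by
    intro i
    exact_mod_cast i.is_lt
  have hi0 : ∀ i : Fin 31, 0 ≤ ((i : ℕ) : ℝ) + 1 := fun i => by positivity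
  have hα : 0 < α := by linarith
  have hvP : ∀ (β : ℝ) (i), (A (v i) (v i) : ℝ) + β * B (v i) (v i) ≤ 62 := by
    intro β i
    rw [hvA, hvB]
    push_cast
    linarith [hi i]
  have hwP : ∀ (β : ℝ) (i), 0 ≤ β → (A (w i) (w i) : ℝ) + β * B (w i) (w i) ≤ 62 * β := by
    intro β i hβ
    rw [hwA, hwB]
    push_cast
    have := mul_le_mul_of_nonneg_left (hi i) hβ
    linarith
  have hzero : ∀ x y, |(α - α') * (B x y : ℝ)| < (α - α') → B x y = 0 := by
    intro x y h
    rw [abs_mul, abs_of_pos (by linarith)] at h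
    have h₁ : |(B x y : ℝ)| < 1 := by
      by_contra! h₂
      have := mul_le_mul_of_nonneg_left h₂ (show 0 ≤ α - α' by linarith)
      linarith
    exact Int.abs_lt_one_iff.1 (by exact_mod_cast h₁)
  have hvv : ∀ i j, B (v i) (v j) = 0 := by
    intro i j
    refine hzero _ _ ?_
    have h₁ := abs_le.1 (abs_two_mul_apply_le hsA hsB hP 1 (v i) (v j))
    have h₂ := abs_le.1 (abs_two_mul_apply_le hsA hsB hP' 1 (v i) (v j))
    have h₃ := hvP α i
    have h₄ := hvP α j
    have h₅ := hvP α' i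
    have h₆ := hvP α' j
    push_cast at h₁ h₂
    rw [abs_lt]
    constructor <;> linarith
  have hvw : ∀ i j, B (v i) (w j) = 0 := by
    intro i j
    refine hzero _ _ ?_
    have h₁ := abs_le.1 (abs_two_mul_apply_le hsA hsB hP 1000 (v i) (w j))
    have h₂ := abs_le.1 (abs_two_mul_apply_le hsA hsB hP' 1 (v i) (w j))
    have h₃ := hvP α i
    have h₄ := hwP α j hα.le
    have h₅ := hvP α' i
    have h₆ := hwP α' j h0.le
    push_cast at h₁ h₂
    rw [abs_lt]
    constructor <;> linarith
  have hww : ∀ i j, |B (w i) (w j)| ≤ 62 := by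
    intro i j
    have h₁ := abs_le.1 (abs_two_mul_apply_le hsA hsB hP 1 (w i) (w j))
    have h₂ := abs_le.1 (abs_two_mul_apply_le hsA hsB hP' 1 (w i) (w j))
    have h₃ := hwP α i hα.le
    have h₄ := hwP α j hα.le
    have h₅ := hwP α' i h0.le
    have h₆ := hwP α' j h0.le
    push_cast at h₁ h₂
    rw [abs_le]
    have hd : 0 < α - α' := by linarith
    constructor
    · by_contra! h
      have : (B (w i) (w j) : ℝ) ≤ -63 := by exact_mod_cast (by omega : B (w i) (w j) ≤ -63)
      have := mul_le_mul_of_nonneg_left this hd.le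
      linarith
    · by_contra! h
      have : (63 : ℝ) ≤ B (w i) (w j) := by exact_mod_cast h
      have := mul_le_mul_of_nonneg_left this hd.le
      linarith
  have hBv : ∀ x ∈ Submodule.span ℤ (Set.range v), 0 ≤ A x x := by
    intro x hx
    have h := hP x
    rw [apply_eq_zero_of_mem_span hvv hx hx, Int.cast_zero, mul_zero, add_zero] at h
    exact_mod_cast h
  obtain ⟨x, hxv, hx⟩ := exists_posDef_four_of_span hsA heA hvA hBv
  obtain ⟨e, hew, he⟩ : ∃ e : Fin 4 → G, (∀ i, e i ∈ Submodule.span ℤ (Set.range w)) ∧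
      ∀ c : Fin 4 → ℤ, c ≠ 0 → 0 < B (∑ i, c i • e i) (∑ i, c i • e i) := by
    have hdich := posDef_four_or_posSemidef (h := fun x => (A x x : ℝ) + α' * B x x) (w := w)
      (b := 62) (H := 62) hsB (fun x y => by
        have h := hP' (x - y)
        simp only [map_add, map_sub, LinearMap.sub_apply, LinearMap.add_apply] at h ⊢
        push_cast at h ⊢
        linarith)
      (fun n x => by
        simp only [map_smul, LinearMap.smul_apply, smul_eq_mul]
        push_cast
        ring)
      hP' (by norm_num)
      (fun i => by
        have := hwP α' i h0.le
        linarith)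
      hww (fun x hx => by
        by_contra! h
        have h₁ : (B x x : ℝ) ≤ -1 := by exact_mod_cast (by omega : B x x ≤ -1)
        have h₂ := mul_le_mul_of_nonneg_left h₁ (show 0 ≤ α - α' by linarith)
        have h₃ := hP x
        push_cast at hx
        norm_num at hx hδ
        linarith)
    rcases hdich with ⟨I, hI⟩ | hpsd
    · exact ⟨fun i => w (I i), fun i => Submodule.subset_span ⟨_, rfl⟩, hI⟩
    · exact exists_posDef_four_of_span hsB heB hwB hpsd
  have hxe : ∀ i j, B (x i) (e j) = 0 := fun i j =>
    apply_eq_zero_of_mem_span hvw (hxv i) (hew j)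
  have hxx : ∀ i j, B (x i) (x j) = 0 := fun i j =>
    apply_eq_zero_of_mem_span hvv (hxv i) (hxv j)
  refine ⟨Sum.elim x e, fun c hc => ?_⟩
  set z : Fin 4 ⊕ Fin 4 → G := Sum.elim x e with hz
  have hc' : c ⬝ᵥ ((gram A z).map (Int.cast : ℤ → ℝ)).mulVec c +
      α * (c ⬝ᵥ ((gram B z).map (Int.cast : ℤ → ℝ)).mulVec c) = 0 := by
    rw [← smul_eq_mul, ← dotProduct_smul, ← dotProduct_add, ← Matrix.smul_mulVec,
      ← Matrix.add_mulVec]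
    refine Finset.sum_eq_zero fun i _ => ?_
    have : (((gram A z).map (Int.cast : ℤ → ℝ) + α • (gram B z).map (Int.cast : ℤ → ℝ)).mulVec c) i
        = 0 := hc i
    rw [this, mul_zero]
  have hcB : c ⬝ᵥ ((gram B z).map (Int.cast : ℤ → ℝ)).mulVec c =
      (c ∘ Sum.inr) ⬝ᵥ ((gram B e).map (Int.cast : ℤ → ℝ)).mulVec (c ∘ Sum.inr) := by
    simp [dotProduct, Matrix.mulVec, gram, hz, hxe, hxx, hsB (e _) (x _)]
  have hBe := Matrix.dotProduct_mulVec_nonneg_of_int (M := (gram B e).map (Int.cast : ℤ → ℝ))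
    (fun c => by
      have h : 0 ≤ B (∑ i, c i • e i) (∑ i, c i • e i) := by
        by_cases hc : c = 0
        · simp [hc]
        · exact (he c hc).le
      rw [self_sum_smul] at h
      have h' : (0 : ℝ) ≤ ((c ⬝ᵥ (gram B e).mulVec c : ℤ) : ℝ) := by exact_mod_cast h
      simpa [dotProduct, Matrix.mulVec] using h') (c ∘ Sum.inr)
  have hPc := pencil_dotProduct_nonneg hP' z c
  have hc₂ : c ∘ Sum.inr = 0 := by
    refine Matrix.eq_zero_of_dotProduct_mulVec_map_eq_zero (isSymm_gram hsB e)
      (fun c hc => by rw [← self_sum_smul]; exact he c hc) ?_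
    rw [← hcB] at hBe ⊢
    have hd : 0 < α - α' := by linarith
    refine le_antisymm (le_of_mul_le_mul_left ?_ hd) hBe
    linarith
  have hc₂' : ∀ i, c (Sum.inr i) = 0 := congrFun hc₂
  have hc₁ : c ∘ Sum.inl = 0 := by
    refine Matrix.eq_zero_of_dotProduct_mulVec_map_eq_zero (isSymm_gram hsA x)
      (fun c hc => by rw [← self_sum_smul]; exact hx c hc) ?_
    rw [hcB, hc₂, zero_dotProduct, mul_zero, add_zero] at hc'
    rw [← hc']
    simp [dotProduct, Matrix.mulVec, gram, hz, hc₂']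
  ext i
  rcases i with i | i
  · exact congrFun hc₁ i
  · exact hc₂' i

end Pencil

end LinearMap.BilinForm

section QuadraticField

variable {D : ℤ} {K : Type*} [Field K]

theorem ratCast_ne_of_sq_eq_squarefree [CharZero K] (hD : 1 < D) (hsf : Squarefree D) {s : K}
    (hs : s ^ 2 = (D : K)) (q : ℚ) : (q : K) ≠ s := by
  rintro rfl
  have h : (D : ℚ) = q * q := by
    rw [← sq]
    exact_mod_cast hs.symm
  obtain ⟨r, hr⟩ := Rat.isSquare_intCast_iff.1 ⟨q, h⟩
  have hu := hsf r ⟨1, by rw [hr, mul_one]⟩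
  rcases Int.isUnit_iff.1 hu with rfl | rfl <;> omega

variable [NumberField K]

theorem exists_rat_add_mul_eq (hD : 1 < D) (hsf : Squarefree D) {sd : K} (hsd : sd ^ 2 = (D : K))
    (hdeg : Module.finrank ℚ K = 2) (x : K) : ∃ p q : ℚ, x = p + q * sd := by
  have hne := ratCast_ne_of_sq_eq_squarefree hD hsf hsd
  have hli : LinearIndependent ℚ ![1, sd] := by
    refine LinearIndependent.pair_iff.2 fun a b hab => ?_
    simp only [Algebra.smul_def, eq_ratCast, mul_one] at hab
    have hb : b = 0 := by
      by_contra hb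
      have hb' : (b : K) ≠ 0 := by exact_mod_cast hb
      refine hne (-a / b) ?_
      push_cast
      rw [div_eq_iff hb']
      linear_combination -hab
    refine ⟨?_, hb⟩
    rw [hb, Rat.cast_zero, zero_mul, add_zero] at hab
    exact_mod_cast hab
  have htop := hli.span_eq_top_of_card_eq_finrank' (by simp [hdeg])
  have hx : x ∈ Submodule.span ℚ (Set.range ![1, sd]) := htop ▸ Submodule.mem_top
  rw [Matrix.range_cons, Matrix.range_cons, Matrix.range_empty, Set.union_empty,
    Set.singleton_union, Submodule.mem_span_pair] at hx
  obtain ⟨p, q, h⟩ := hx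
  exact ⟨p, q, by simpa [Algebra.smul_def] using h.symm⟩

theorem rat_add_mul_injective (hD : 1 < D) (hsf : Squarefree D) {sd : K}
    (hsd : sd ^ 2 = (D : K)) {p q p' q' : ℚ} (h : (p : K) + q * sd = p' + q' * sd) :
    p = p' ∧ q = q' := by
  have hq : q = q' := by
    by_contra hq
    have hq' : (q : K) - q' ≠ 0 := by
      rw [sub_ne_zero]
      exact_mod_cast hq
    refine ratCast_ne_of_sq_eq_squarefree hD hsf hsd ((p' - p) / (q - q')) ?_
    push_cast
    rw [div_eq_iff hq']
    linear_combination -h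
  refine ⟨?_, hq⟩
  rw [hq, add_left_inj] at h
  exact_mod_cast h

theorem exists_ringHom_of_sq_eq (hD : 1 < D) (hsf : Squarefree D) {sd : K}
    (hsd : sd ^ 2 = (D : K)) (hdeg : Module.finrank ℚ K = 2) {F : Type*} [Field F] [CharZero F]
    {s : F} (hs : s ^ 2 = (D : F)) : ∃ σ : K →+* F, σ sd = s := by
  choose p q hpq using exists_rat_add_mul_eq hD hsf hsd hdeg
  have huniq : ∀ (x : K) (a b : ℚ), x = a + b * sd → p x = a ∧ q x = b := fun x a b h =>
    rat_add_mul_injective hD hsf hsd ((hpq x).symm.trans h)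
  have h0 := huniq 0 0 0 (by simp)
  have h1 := huniq 1 1 0 (by simp)
  have hadd : ∀ x y, p (x + y) = p x + p y ∧ q (x + y) = q x + q y := fun x y =>
    huniq _ _ _ (by push_cast; linear_combination hpq x + hpq y)
  have hmul : ∀ x y, p (x * y) = p x * p y + D * (q x * q y) ∧
      q (x * y) = p x * q y + q x * p y := fun x y => huniq _ _ _ (by
    conv_lhs => rw [hpq x, hpq y]
    push_cast
    linear_combination (q x * q y : K) * hsd)
  have hgen := huniq sd 0 1 (by simp)
  refine ⟨{ toFun := fun x => (p x : F) + q x * s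
            map_one' := by simp [h1]
            map_zero' := by simp [h0]
            map_add' := fun x y => ?_
            map_mul' := fun x y => ?_ }, ?_⟩
  · simp only [(hmul x y).1, (hmul x y).2]
    push_cast
    linear_combination -(q x * q y : F) * hs
  · simp only [(hadd x y).1, (hadd x y).2]
    push_cast
    ring
  · simp [hgen]

theorem exists_intCast_eq_of_isIntegral_ratCast {r : ℚ} (h : IsIntegral ℤ (r : K)) :
    ∃ n : ℤ, (n : ℚ) = r := by
  rw [← eq_ratCast (algebraMap ℚ K) r,
    isIntegral_algebraMap_iff (algebraMap ℚ K).injective] at h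
  exact IsIntegrallyClosed.isIntegral_iff.1 h

theorem exists_two_mul_eq_of_isIntegral (hD : 1 < D) (hsf : Squarefree D) {sd : K}
    (hsd : sd ^ 2 = (D : K)) (hdeg : Module.finrank ℚ K = 2) {x : K} (hx : IsIntegral ℤ x) :
    ∃ P R : ℤ, 2 * x = P + R * sd := by
  obtain ⟨p, q, hpq⟩ := exists_rat_add_mul_eq hD hsf hsd hdeg x
  obtain ⟨τ, hτ⟩ := exists_ringHom_of_sq_eq hD hsf hsd hdeg (F := K) (s := -sd)
    (by rw [neg_sq, hsd])
  have hτx : τ x = p - q * sd := by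
    rw [hpq, map_add, map_mul, hτ, map_ratCast, map_ratCast]
    ring
  have hτi : IsIntegral ℤ (τ x) := map_isIntegral_int τ hx
  have hsdi : IsIntegral ℤ sd := by
    refine IsIntegral.of_pow (n := 2) two_pos ?_
    rw [hsd]
    exact isIntegral_algebraMap (R := ℤ) (x := D)
  obtain ⟨P, hP⟩ := exists_intCast_eq_of_isIntegral_ratCast (K := K) (r := 2 * p) (by
    rw [show ((2 * p : ℚ) : K) = x + τ x by rw [hτx, hpq]; push_cast; ring]
    exact hx.add hτi)
  obtain ⟨k, hk⟩ := exists_intCast_eq_of_isIntegral_ratCast (K := K) (r := 2 * q * D) (by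
    rw [show ((2 * q * D : ℚ) : K) = (x - τ x) * sd by
      rw [hτx, hpq]
      push_cast
      linear_combination -2 * (q : K) * hsd]
    exact (hx.sub hτi).mul hsdi)
  obtain ⟨m, hm⟩ := exists_intCast_eq_of_isIntegral_ratCast (K := K) (r := (2 * q) ^ 2 * D) (by
    rw [show (((2 * q) ^ 2 * D : ℚ) : K) = (x - τ x) ^ 2 by
      rw [hτx, hpq]
      push_cast
      linear_combination -4 * (q : K) ^ 2 * hsd]
    exact (hx.sub hτi).pow 2)
  have hD0 : (D : ℚ) ≠ 0 := by
    exact_mod_cast (by omega : D ≠ 0)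
  have hdvd : D ∣ k ^ 2 := by
    refine ⟨m, ?_⟩
    have : (k : ℚ) ^ 2 = D * m := by
      rw [hk, hm]
      ring
    exact_mod_cast this
  obtain ⟨R, hR⟩ := (hsf.dvd_pow_iff_dvd two_ne_zero).1 hdvd
  refine ⟨P, R, ?_⟩
  have hR' : (R : ℚ) = 2 * q := by
    rw [hR] at hk
    push_cast at hk
    exact mul_left_cancel₀ hD0 (by linarith)
  have hP' : ((P : ℚ) : K) = ((2 * p : ℚ) : K) := by rw [hP]
  have hR'' : ((R : ℚ) : K) = ((2 * q : ℚ) : K) := by rw [hR']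
  push_cast at hP' hR''
  rw [hP', hR'', hpq]
  ring

/-- The ring of integers of a quadratic field is generated by one element over `ℤ`. -/
theorem exists_integral_generator (hD : 1 < D) (hsf : Squarefree D) {sd : K}
    (hsd : sd ^ 2 = (D : K)) (hdeg : Module.finrank ℚ K = 2) :
    ∃ (α : K) (a t : ℚ), 1 / 2 ≤ t ∧ α = a + t * sd ∧ IsIntegral ℤ α ∧
      ∀ x : K, IsIntegral ℤ x → ∃ u y : ℤ, x = u + y * α := by
  have hint : ∀ n : ℤ, IsIntegral ℤ (n : K) := fun n => isIntegral_algebraMap (R := ℤ) (x := n)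
  have hsdi : IsIntegral ℤ sd := by
    refine IsIntegral.of_pow (n := 2) two_pos ?_
    rw [hsd]
    exact hint D
  have hhalf : ∀ (x : K) (P : ℤ), IsIntegral ℤ x → 2 * x = P → ∃ u : ℤ, x = u := by
    intro x P hx h
    have hx' : x = ((P / 2 : ℚ) : K) := by
      push_cast
      linear_combination h / 2
    rw [hx'] at hx
    obtain ⟨u, hu⟩ := exists_intCast_eq_of_isIntegral_ratCast hx
    exact ⟨u, by rw [hx', ← hu, Rat.cast_intCast]⟩
  by_cases hodd : ∃ (x : K) (P r : ℤ), IsIntegral ℤ x ∧ 2 * x = P + (2 * r + 1) * sd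
  · obtain ⟨x, P, r, hx, hxP⟩ := hodd
    have hα : IsIntegral ℤ (x - r * sd) := hx.sub ((hint r).mul hsdi)
    refine ⟨x - r * sd, P / 2, 1 / 2, le_rfl, ?_, hα, fun y hy => ?_⟩
    · push_cast
      linear_combination hxP / 2
    · obtain ⟨P', R', hP'⟩ := exists_two_mul_eq_of_isIntegral hD hsf hsd hdeg hy
      obtain ⟨u, hu⟩ := hhalf (y - R' * (x - r * sd)) (P' - R' * P)
        (hy.sub ((hint R').mul hα)) (by
          push_cast
          linear_combination hP' - R' * hxP)
      exact ⟨u, R', by linear_combination hu⟩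
  · push Not at hodd
    refine ⟨sd, 0, 1, by norm_num, by simp, hsdi, fun y hy => ?_⟩
    obtain ⟨P, R, hP⟩ := exists_two_mul_eq_of_isIntegral hD hsf hsd hdeg hy
    obtain ⟨r, rfl | rfl⟩ := Int.even_or_odd' R
    · obtain ⟨u, hu⟩ := hhalf (y - r * sd) P (hy.sub ((hint r).mul hsdi)) (by
        push_cast at hP
        linear_combination hP)
      exact ⟨u, r, by linear_combination hu⟩
    · exact absurd (by push_cast at hP; exact hP) (hodd y P r hy)

/-- In a real quadratic field of large discriminant the ring of integers has a totally positive
generator whose smaller conjugate is at most one. -/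
theorem exists_totallyPositive_generator (hD : 1 < D) (hsf : Squarefree D) {sd : K}
    (hsd : sd ^ 2 = (D : K)) (hdeg : Module.finrank ℚ K = 2) {N : ℕ} (hN : (N : ℤ) ^ 2 ≤ D) :
    ∃ (α : K) (σ₁ σ₂ : K →+* ℝ), IsIntegral ℤ α ∧
      (∀ x : K, IsIntegral ℤ x → ∃ u y : ℤ, x = u + y * α) ∧ 0 < σ₂ α ∧ σ₂ α ≤ 1 ∧
      N ≤ σ₁ α - σ₂ α ∧ ∀ σ : K →+* ℝ, 0 < σ α := by
  obtain ⟨α, a, t, ht, hα, hαi, hgen⟩ := exists_integral_generator hD hsf hsd hdeg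
  have hD0 : (0 : ℝ) ≤ D := by exact_mod_cast (by omega : 0 ≤ D)
  have hsq : √(D : ℝ) ^ 2 = (D : ℝ) := Real.sq_sqrt hD0
  obtain ⟨σ₁, hσ₁⟩ := exists_ringHom_of_sq_eq hD hsf hsd hdeg hsq
  obtain ⟨σ₂, hσ₂⟩ := exists_ringHom_of_sq_eq hD hsf hsd hdeg (F := ℝ) (s := -√(D : ℝ))
    (by rw [neg_sq, hsq])
  have hval : ∀ σ : K →+* ℝ, σ α = a + t * σ sd := fun σ => by
    rw [hα, map_add, map_mul, map_ratCast, map_ratCast]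
  have ht' : (1 / 2 : ℝ) ≤ t := by
    have : (((1 / 2 : ℚ)) : ℝ) ≤ t := by exact_mod_cast ht
    simpa using this
  have hNs : (N : ℝ) ≤ √(D : ℝ) := Real.le_sqrt_of_sq_le (by exact_mod_cast hN)
  have hts : 1 / 2 * √(D : ℝ) ≤ t * √(D : ℝ) :=
    mul_le_mul_of_nonneg_right ht' (Real.sqrt_nonneg _)
  have hdiff : (N : ℝ) ≤ σ₁ α - σ₂ α := by
    rw [hval, hval, hσ₁, hσ₂]
    linarith
  set m : ℤ := 1 - ⌈σ₂ α⌉ with hm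
  have hshift : ∀ σ : K →+* ℝ, σ (α + m) = σ α + m := fun σ => by rw [map_add, map_intCast]
  have hm₁ : 0 < σ₂ α + m := by
    rw [hm]
    push_cast
    linarith [Int.ceil_lt_add_one (σ₂ α)]
  have hm₂ : σ₂ α + m ≤ 1 := by
    rw [hm]
    push_cast
    linarith [Int.le_ceil (σ₂ α)]
  refine ⟨α + m, σ₁, σ₂, hαi.add (isIntegral_algebraMap (R := ℤ) (x := m)), fun x hx => ?_,
    by rwa [hshift], by rwa [hshift], by rw [hshift, hshift]; linarith, fun σ => ?_⟩
  · obtain ⟨u, y, hxy⟩ := hgen x hx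
    exact ⟨u - y * m, y, by push_cast; linear_combination hxy⟩
  · rw [hshift]
    have hσ : σ sd ^ 2 = √(D : ℝ) ^ 2 := by rw [← map_pow, hsd, map_intCast, hsq]
    rcases sq_eq_sq_iff_eq_or_eq_neg.1 hσ with h | h
    · have : σ α = σ₁ α := by rw [hval, hval, h, hσ₁]
      rw [this]
      linarith [(N.cast_nonneg : (0 : ℝ) ≤ N)]
    · have : σ α = σ₂ α := by rw [hval, hval, h, hσ₂]
      rwa [this]

end QuadraticField

/-- The coordinates of the polar form of an integral quadratic lattice with respect to an integral
basis `1, α` are symmetric even integral bilinear forms. -/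
theorem exists_polar_coordinates {K : Type*} [Field K] [CharZero K] {V : Type*} [AddCommGroup V]
    [Module K V] {Q : QuadraticForm K V} {L : AddSubgroup V} {α : K} {S : Subring K}
    (hint : ∀ x ∈ L, Q x ∈ S) (hgen : ∀ x ∈ S, ∃ u y : ℤ, x = u + y * α)
    (huniq : ∀ u y : ℤ, (u : K) + y * α = 0 → u = 0 ∧ y = 0) :
    ∃ A B : LinearMap.BilinForm ℤ L, (∀ x y, A x y = A y x) ∧ (∀ x y, B x y = B y x) ∧
      (∀ x, Even (A x x)) ∧ (∀ x, Even (B x x)) ∧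
      ∀ x y : L, QuadraticMap.polar Q x y = A x y + B x y * α := by
  have hinj : ∀ u y u' y' : ℤ, (u : K) + y * α = u' + y' * α → u = u' ∧ y = y' := by
    intro u y u' y' h
    obtain ⟨h₁, h₂⟩ := huniq (u - u') (y - y') (by push_cast; linear_combination h)
    omega
  have hex : ∀ x y : L, ∃ u t : ℤ, QuadraticMap.polar Q x y = u + t * α := fun x y =>
    hgen _ (S.sub_mem (S.sub_mem (hint _ (L.add_mem x.2 y.2)) (hint _ x.2)) (hint _ y.2))
  choose A B hAB using hex
  have hsymm : ∀ x y, A x y = A y x ∧ B x y = B y x := fun x y =>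
    hinj _ _ _ _ (by rw [← hAB, ← hAB, QuadraticMap.polar_comm])
  have hadd : ∀ x x' y, A (x + x') y = A x y + A x' y ∧ B (x + x') y = B x y + B x' y := by
    refine fun x x' y => hinj _ _ _ _ ?_
    have h := QuadraticMap.polar_add_left Q (x : V) x' y
    rw [← AddSubgroup.coe_add, hAB, hAB, hAB] at h
    push_cast
    linear_combination h
  have hsmul : ∀ (n : ℤ) x y, A (n • x) y = n * A x y ∧ B (n • x) y = n * B x y := by
    refine fun n x y => hinj _ _ _ _ ?_
    have h := QuadraticMap.polar_smul_left Q (n : K) (x : V) y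
    rw [Int.cast_smul_eq_zsmul, ← AddSubgroup.coe_zsmul, hAB, hAB, smul_eq_mul] at h
    push_cast
    linear_combination h
  refine ⟨LinearMap.mk₂ ℤ A (fun x x' y => (hadd x x' y).1) (fun n x y => (hsmul n x y).1)
      (fun x y y' => by simp only [(hsymm x _).1, (hadd _ _ _).1])
      (fun n x y => by simp only [(hsymm x _).1, (hsmul _ _ _).1, smul_eq_mul]),
    LinearMap.mk₂ ℤ B (fun x x' y => (hadd x x' y).2) (fun n x y => (hsmul n x y).2)
      (fun x y y' => by simp only [(hsymm x _).2, (hadd _ _ _).2])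
      (fun n x y => by simp only [(hsymm x _).2, (hsmul _ _ _).2, smul_eq_mul]),
    fun x y => (hsymm x y).1, fun x y => (hsymm x y).2, fun x => ?_, fun x => ?_, hAB⟩
  all_goals
    obtain ⟨u, y, h⟩ := hgen _ (hint x x.2)
    have h₁ := hAB x x
    rw [QuadraticMap.polar_self, h] at h₁
    obtain ⟨h₂, h₃⟩ := hinj (2 * u) (2 * y) _ _ (by
      rw [← h₁]
      push_cast
      simp only [nsmul_eq_mul]
      push_cast
      ring)
  · exact ⟨u, by rw [LinearMap.mk₂_apply]; omega⟩
  · exact ⟨y, by rw [LinearMap.mk₂_apply]; omega⟩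

/-- If `K = ℚ(√D)` (`D > 1` squarefree) admits a universal quadratic
`𝓞 K`-lattice `(L, Q)` of rank at most 7, then
`D < (576283867731072000000005)²`.  Here `(L, Q)` is a finitely generated
`𝓞 K`-submodule of a finite-dimensional `K`-vector space `V` together with a
quadratic form `Q : V → K`; it is integral, totally positive definite, of rank
`dim_K (K·L) ≤ 7`, and represents every totally positive element of `𝓞 K`. -/
theorem universal_rank_le_seven_bound
    (D : ℤ) (hD : 1 < D) (hsf : Squarefree D)
    (K : Type) [Field K] [NumberField K]
    (sd : K) (hsd : sd ^ 2 = (D : K)) (hdeg : Module.finrank ℚ K = 2)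
    (V : Type) [AddCommGroup V] [Module K V] [FiniteDimensional K V]
    [Module (𝓞 K) V] [IsScalarTower (𝓞 K) K V]
    (L : Submodule (𝓞 K) V) (hLfg : L.FG)
    (Q : QuadraticForm K V)
    (hrank : Module.finrank K (Submodule.span K (L : Set V)) ≤ 7)
    (hint : ∀ x ∈ L, IsIntegral ℤ (Q x))
    (hposdef : ∀ x ∈ L, x ≠ 0 → ∀ σ : K →+* ℝ, 0 < σ (Q x))
    (huniversal : ∀ α : 𝓞 K, (∀ σ : K →+* ℝ, 0 < σ (α : K)) →
      ∃ x ∈ L, Q x = (α : K)) :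
    D < 576283867731072000000005 ^ 2 := by
  by_contra! hbig
  obtain ⟨α, σ₁, σ₂, hαi, hgen, hα₂, hα₂', hαδ, hαpos⟩ :=
    exists_totallyPositive_generator (N := 10 ^ 23) hD hsf hsd hdeg (by norm_num at hbig ⊢; omega)
  have hint' : ∀ x ∈ L.toAddSubgroup, Q x ∈ (integralClosure ℤ K).toSubring := hint
  have hδ0 : σ₁ α - σ₂ α ≠ 0 := by
    push_cast at hαδ
    exact (lt_of_lt_of_le (by norm_num) hαδ).ne'
  have huniq : ∀ u y : ℤ, (u : K) + y * α = 0 → u = 0 ∧ y = 0 := fun u y h => by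
    have h₁ := congrArg σ₁ h
    have h₂ := congrArg σ₂ h
    simp only [map_add, map_mul, map_intCast, map_zero] at h₁ h₂
    have hy : (y : ℝ) * (σ₁ α - σ₂ α) = 0 := by linear_combination h₁ - h₂
    have hy' : (y : ℝ) = 0 := (mul_eq_zero.1 hy).resolve_right hδ0
    rw [hy', zero_mul, add_zero] at h₁
    exact ⟨by exact_mod_cast h₁, by exact_mod_cast hy'⟩
  obtain ⟨A, B, hsA, hsB, heA, heB, hAB⟩ := exists_polar_coordinates hint' hgen huniq
  have hσ : ∀ (σ : K →+* ℝ) (x : L.toAddSubgroup),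
      (A x x : ℝ) + σ α * B x x = 2 * σ (Q x) := by
    intro σ x
    have h := congrArg σ (hAB x x)
    rw [QuadraticMap.polar_self] at h
    simp only [map_add, map_mul, map_intCast, nsmul_eq_mul, Nat.cast_ofNat, map_ofNat] at h
    linear_combination -h
  have hpos : ∀ (σ : K →+* ℝ) (x : L.toAddSubgroup), 0 ≤ (A x x : ℝ) + σ α * B x x := by
    intro σ x
    rw [hσ]
    by_cases hx : (x : V) = 0
    · simp [hx]
    · exact (mul_pos two_pos (hposdef x x.2 hx σ)).le
  have hrep : ∀ a b : ℕ, 0 < a + b →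
      ∃ x : L.toAddSubgroup, A x x = 2 * (a : ℤ) ∧ B x x = 2 * (b : ℤ) := by
    intro a b hab
    have hi : IsIntegral ℤ ((a : K) + b * α) :=
      (isIntegral_natCast a).add ((isIntegral_natCast b).mul hαi)
    obtain ⟨x, hx, hQ⟩ := huniversal ⟨_, hi⟩ fun σ => by
      change 0 < σ ((a : K) + b * α)
      rw [map_add, map_mul, map_natCast, map_natCast]
      have h := hαpos σ
      rcases Nat.eq_zero_or_pos a with rfl | ha
      · have hb : 0 < b := by omega
        positivity
      · positivity
    replace hQ : Q x = a + b * α := hQ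
    refine ⟨⟨x, hx⟩, ?_⟩
    have h := hAB ⟨x, hx⟩ ⟨x, hx⟩
    rw [QuadraticMap.polar_self, hQ, nsmul_eq_mul] at h
    have h' := huniq (A ⟨x, hx⟩ ⟨x, hx⟩ - 2 * a) (B ⟨x, hx⟩ ⟨x, hx⟩ - 2 * b) (by
      push_cast at h ⊢
      linear_combination -h)
    omega
  choose v hvA hvB using fun i : Fin 31 => hrep (i + 1) 0 (by omega)
  choose w hwA hwB using fun i : Fin 31 => hrep 0 (i + 1) (by omega)
  obtain ⟨z, hz⟩ := LinearMap.BilinForm.exists_eight_nondegenerate hsA hsB heA heB hα₂ hα₂'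
    (by exact_mod_cast hαδ) (hpos σ₁) (hpos σ₂) (v := v) (w := w) (by simpa using hvA)
    (by simpa using hvB) (by simpa using hwA) (by simpa using hwB)
  have hli : LinearIndependent K fun i => (z i : V) := by
    refine Fintype.linearIndependent_iff.2 fun g hg => ?_
    have hc := hz (fun j => σ₁ (g j)) fun i => by
      have h := congrArg (QuadraticMap.polarBilin Q (z i)) hg
      simp only [map_sum, map_smul, map_zero, QuadraticMap.polarBilin_apply_apply, hAB,
        smul_eq_mul] at h
      have h' := congrArg σ₁ h
      simp only [map_sum, map_mul, map_add, map_intCast, map_zero] at h'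
      rw [← h']
      exact Finset.sum_congr rfl fun j _ => by ring
    exact fun i => (map_eq_zero σ₁).1 (congrFun hc i)
  have hcard := finrank_span_eq_card hli
  have hle := Submodule.finrank_mono (R := K) (Submodule.span_mono
    (Set.range_subset_iff.2 fun i => (z i).2 : Set.range (fun i => (z i : V)) ⊆ (L : Set V)))
  rw [hcard] at hle
  simp only [Fintype.card_sum, Fintype.card_fin] at hle
  omega
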